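/- If n = p + q and ω is a double form of bidegree (p,q) on an n-dimensional Euclidean space, then for every k ≥ 0, c^k(g^k ω) = g^k(c^k ω). -/

import Mathlib

open scoped BigOperators

namespace DoubleForm

/-- The model Euclidean vector space of dimension `n` (with the standard inner product). -/
abbrev V (n : ℕ) := Fin n → ℝ

/-- The standard orthonormal basis of `V n`. -/
def E (n : ℕ) (j : Fin n) : V n := fun k => if k = j then 1 else 0

/-- Raw double forms of bidegree `(p,q)`: real valued functions of `p` vectors and `q` vectors.
Genuine double forms are singled out by `IsDF`. -/
abbrev DF (n p q : ℕ) := (Fin p → V n) → (Fin q → V n) → ℝ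

/-- `ω` is a genuine double form: multilinear and alternating in the first `p`
and in the last `q` arguments. -/
def IsDF {n p q : ℕ} (ω : DF n p q) : Prop :=
  ∃ F : AlternatingMap ℝ (V n) (AlternatingMap ℝ (V n) ℝ (Fin q)) (Fin p),
    ∀ x y, ω x y = F x y

/-- Transport of double forms along equalities of the degrees. -/
def DFcast {n p q p' q' : ℕ} (h1 : p = p') (h2 : q = q') (ω : DF n p q) : DF n p' q' :=
  fun x y => ω (fun i => x (Fin.cast h1 i)) (fun j => y (Fin.cast h2 j))

/-- The product of double forms (Kulkarni's product). -/
noncomputable def mul {n p q r s : ℕ} (ω : DF n p q) (η : DF n r s) :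
    DF n (p + r) (q + s) := fun x y =>
  (((p.factorial * r.factorial * q.factorial * s.factorial : ℕ) : ℝ))⁻¹ *
    ∑ σ : Equiv.Perm (Fin (p + r)), ∑ ρ : Equiv.Perm (Fin (q + s)),
      ((Equiv.Perm.sign σ : ℤ) : ℝ) * ((Equiv.Perm.sign ρ : ℤ) : ℝ) *
        ω (fun i => x (σ (Fin.castAdd r i))) (fun j => y (ρ (Fin.castAdd s j))) *
        η (fun i => x (σ (Fin.natAdd p i))) (fun j => y (ρ (Fin.natAdd q j)))

/-- The metric `g` as a double form of bidegree `(1,1)`. -/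
noncomputable def gm (n : ℕ) : DF n 1 1 := fun x y => ∑ j : Fin n, x 0 j * y 0 j

/-- Powers `g^l` of the metric in the algebra of double forms. -/
noncomputable def gpow (n : ℕ) : (l : ℕ) → DF n l l
  | 0 => fun _ _ => 1
  | l + 1 => mul (gpow n l) (gm n)

/-- The contraction map `c : D^{p,q} → D^{p-1,q-1}` (zero if `p = 0` or `q = 0`). -/
noncomputable def contr {n : ℕ} : ∀ {p q : ℕ}, DF n p q → DF n (p - 1) (q - 1)
  | p + 1, q + 1, ω => fun x y =>
      ∑ j : Fin n, ω (Fin.cons (E n j) x) (Fin.cons (E n j) y)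
  | 0, _, _ => 0
  | _ + 1, 0, _ => 0

/-- Iterated contraction `c^k`. -/
noncomputable def ck {n : ℕ} : ∀ (k : ℕ) {p q : ℕ}, DF n p q → DF n (p - k) (q - k)
  | 0, _, _, ω => ω
  | k + 1, _, _, ω => contr (ck k ω)

/-- The natural inner product on `D^{p,q}`. -/
noncomputable def innerDF {n p q : ℕ} (ω θ : DF n p q) : ℝ :=
  (((p.factorial * q.factorial : ℕ) : ℝ))⁻¹ *
    ∑ f : Fin p → Fin n, ∑ g : Fin q → Fin n,
      ω (fun i => E n (f i)) (fun j => E n (g j)) *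
        θ (fun i => E n (f i)) (fun j => E n (g j))

/-- The natural inner product extended to all bidegrees: distinct bidegrees are orthogonal. -/
noncomputable def innerDF2 {n p q r s : ℕ} (ω : DF n p q) (θ : DF n r s) : ℝ :=
  if h : p = r ∧ q = s then innerDF (DFcast h.1 h.2 ω) θ else 0

/-- Determinant of the `n × n` matrix whose first `p` rows are the basis vectors `E (f i)`
and whose remaining rows are the vectors `x`. -/
noncomputable def rowsDet {n : ℕ} (p : ℕ) (f : Fin p → Fin n) (x : Fin (n - p) → V n) : ℝ :=
  Matrix.det (Matrix.of fun i k : Fin n =>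
    if h : (i : ℕ) < p then E n (f ⟨(i : ℕ), h⟩) k
    else x ⟨(i : ℕ) - p, by have := i.isLt; omega⟩ k)

/-- The Hodge star operator extended to double forms, `D^{p,q} → D^{n-p,n-q}`. -/
noncomputable def hstar {n p q : ℕ} (ω : DF n p q) : DF n (n - p) (n - q) := fun x y =>
  (((p.factorial * q.factorial : ℕ) : ℝ))⁻¹ *
    ∑ f : Fin p → Fin n, ∑ g : Fin q → Fin n,
      ω (fun i => E n (f i)) (fun j => E n (g j)) * rowsDet p f x * rowsDet q g y

/-- The first Bianchi sum `B : D^{p,q} → D^{p+1,q-1}` (zero if `q = 0`). -/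
noncomputable def bianchi {n : ℕ} : ∀ {p q : ℕ}, DF n p q → DF n (p + 1) (q - 1)
  | p, q + 1, ω => fun x y =>
      ∑ j : Fin (p + 1), (-1 : ℝ) ^ ((j : ℕ) + 1) *
        ω (fun i => x (j.succAbove i)) (Fin.cons (x j) y)
  | _, 0, _ => 0

/-- Symmetric double forms of bidegree `(p,p)`. -/
def IsSymm {n p : ℕ} (ω : DF n p p) : Prop := ∀ x y, ω x y = ω y x

/-- The total (bigraded) space of double forms. -/
abbrev DT (n : ℕ) := ∀ p q : ℕ, DF n p q

/-- Embedding of the component `D^{p,q}` into the total space. -/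
noncomputable def emb {n : ℕ} (p q : ℕ) (ω : DF n p q) : DT n := fun p' q' =>
  if h : p = p' ∧ q = q' then DFcast h.1 h.2 ω else 0


/-! ### Antisymmetrization and the product -/

/-- Unnormalized antisymmetrization of a double form in both groups of arguments. -/
noncomputable def altz {n p q : ℕ} (f : DF n p q) : DF n p q := fun x y =>
  ∑ σ : Equiv.Perm (Fin p), ∑ ρ : Equiv.Perm (Fin q),
    ((Equiv.Perm.sign σ : ℤ) : ℝ) * ((Equiv.Perm.sign ρ : ℤ) : ℝ) *
      f (fun i => x (σ i)) (fun j => y (ρ j))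

/-- The tensor product of double forms. -/
def tens {n p q r s : ℕ} (f : DF n p q) (h : DF n r s) : DF n (p + r) (q + s) := fun x y =>
  f (fun i => x (Fin.castAdd r i)) (fun j => y (Fin.castAdd s j)) *
    h (fun i => x (Fin.natAdd p i)) (fun j => y (Fin.natAdd q j))

theorem mul_eq_altz {n p q r s : ℕ} (ω : DF n p q) (η : DF n r s) (x : Fin (p + r) → V n)
    (y : Fin (q + s) → V n) :
    mul ω η x y = (((p.factorial * r.factorial * q.factorial * s.factorial : ℕ) : ℝ))⁻¹ *
      altz (tens ω η) x y := by
  simp only [mul, altz, tens, mul_assoc]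

/-- The permutation of `Fin (p + r)` acting by `τ` on the first `p` indices. -/
def permLeft {p : ℕ} (r : ℕ) (τ : Equiv.Perm (Fin p)) : Equiv.Perm (Fin (p + r)) :=
  finSumFinEquiv.permCongr (Equiv.Perm.sumCongr τ 1)

theorem sign_permLeft {p : ℕ} (r : ℕ) (τ : Equiv.Perm (Fin p)) :
    Equiv.Perm.sign (permLeft r τ) = Equiv.Perm.sign τ := by
  simp [permLeft, Equiv.Perm.sign_permCongr]

theorem permLeft_castAdd {p : ℕ} (r : ℕ) (τ : Equiv.Perm (Fin p)) (i : Fin p) :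
    permLeft r τ (Fin.castAdd r i) = Fin.castAdd r (τ i) := by
  simp [permLeft]

theorem permLeft_natAdd {p : ℕ} (r : ℕ) (τ : Equiv.Perm (Fin p)) (i : Fin r) :
    permLeft r τ (Fin.natAdd p i) = Fin.natAdd p i := by
  simp [permLeft]

theorem sign_mul_sign_cast {p : ℕ} (σ : Equiv.Perm (Fin p)) :
    ((Equiv.Perm.sign σ : ℤ) : ℝ) * ((Equiv.Perm.sign σ : ℤ) : ℝ) = 1 := by
  rcases Int.units_eq_one_or (Equiv.Perm.sign σ) with h | h <;> simp [h]

theorem altz_tens_altz {n p q r s : ℕ} (f : DF n p q) (h : DF n r s) (x : Fin (p + r) → V n)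
    (y : Fin (q + s) → V n) :
    altz (tens (altz f) h) x y =
      ((p.factorial * q.factorial : ℕ) : ℝ) * altz (tens f h) x y := by
  have key : ∀ (τ : Equiv.Perm (Fin p)) (υ : Equiv.Perm (Fin q)),
      ∑ σ : Equiv.Perm (Fin (p + r)), ∑ ρ : Equiv.Perm (Fin (q + s)),
        ((Equiv.Perm.sign σ : ℤ) : ℝ) * ((Equiv.Perm.sign ρ : ℤ) : ℝ) *
          (((Equiv.Perm.sign τ : ℤ) : ℝ) * ((Equiv.Perm.sign υ : ℤ) : ℝ) *
            f (fun i => x (σ (Fin.castAdd r (τ i)))) (fun j => y (ρ (Fin.castAdd s (υ j)))) *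
            h (fun i => x (σ (Fin.natAdd p i))) (fun j => y (ρ (Fin.natAdd q j))))
      = altz (tens f h) x y := by
    intro τ υ
    unfold altz
    symm
    rw [← Equiv.sum_comp (Equiv.mulRight (permLeft r τ))]
    refine Finset.sum_congr rfl fun σ _ => ?_
    rw [← Equiv.sum_comp (Equiv.mulRight (permLeft s υ))]
    refine Finset.sum_congr rfl fun ρ _ => ?_
    simp only [tens, Equiv.coe_mulRight, Equiv.Perm.sign_mul, sign_permLeft, Equiv.Perm.coe_mul,
      Function.comp_apply, permLeft_castAdd, permLeft_natAdd, Units.val_mul, Int.cast_mul]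
    ring
  calc altz (tens (altz f) h) x y
      = ∑ σ : Equiv.Perm (Fin (p + r)), ∑ ρ : Equiv.Perm (Fin (q + s)),
        ∑ τ : Equiv.Perm (Fin p), ∑ υ : Equiv.Perm (Fin q),
        ((Equiv.Perm.sign σ : ℤ) : ℝ) * ((Equiv.Perm.sign ρ : ℤ) : ℝ) *
          (((Equiv.Perm.sign τ : ℤ) : ℝ) * ((Equiv.Perm.sign υ : ℤ) : ℝ) *
            f (fun i => x (σ (Fin.castAdd r (τ i)))) (fun j => y (ρ (Fin.castAdd s (υ j)))) *
            h (fun i => x (σ (Fin.natAdd p i))) (fun j => y (ρ (Fin.natAdd q j)))) := by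
        simp only [altz, tens, Finset.sum_mul, Finset.mul_sum]
    _ = ∑ τ : Equiv.Perm (Fin p), ∑ υ : Equiv.Perm (Fin q), altz (tens f h) x y := by
        rw [Finset.sum_congr rfl fun σ _ => Finset.sum_comm, Finset.sum_comm]
        refine Finset.sum_congr rfl fun τ _ => ?_
        rw [Finset.sum_congr rfl fun σ _ => Finset.sum_comm, Finset.sum_comm]
        exact Finset.sum_congr rfl fun υ _ => key τ υ
    _ = _ := by
        simp [Fintype.card_perm, mul_assoc]

theorem mul_altz {n p q r s : ℕ} (f : DF n p q) (h : DF n r s) (x : Fin (p + r) → V n)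
    (y : Fin (q + s) → V n) :
    mul (altz f) h x y =
      ((r.factorial * s.factorial : ℕ) : ℝ)⁻¹ * altz (tens f h) x y := by
  rw [mul_eq_altz, altz_tens_altz]
  have := Nat.factorial_ne_zero p
  have := Nat.factorial_ne_zero q
  have := Nat.factorial_ne_zero r
  have := Nat.factorial_ne_zero s
  push_cast
  field_simp

/-- The tensor power `g ⊗ ⋯ ⊗ g` (with `k` factors) of the metric. -/
noncomputable def tpow (n k : ℕ) : DF n k k := fun x y => ∏ i, x i ⬝ᵥ y i

theorem gpow_eq_altz (n k : ℕ) : gpow n k = altz (tpow n k) := by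
  induction k with
  | zero =>
    funext x y
    simp [gpow, altz, tpow]
  | succ k ih =>
    funext x y
    rw [gpow, ih, mul_altz]
    have : tens (tpow n k) (gm n) = tpow n (k + 1) := by
      funext x y
      simp only [tens, tpow, gm, Fin.prod_univ_castSucc]
      rfl
    simp [this]

/-! ### Multiplication by the metric -/

/-- Multiplication of a double form by the metric, in expanded form. -/
noncomputable def gStep {n p q : ℕ} (ω : DF n p q) : DF n (p + 1) (q + 1) := fun x y =>
  ∑ i : Fin (p + 1), ∑ j : Fin (q + 1),
    (-1 : ℝ) ^ (i : ℕ) * (-1 : ℝ) ^ (j : ℕ) * (x i ⬝ᵥ y j) * ω (i.removeNth x) (j.removeNth y)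

/-- Iterated multiplication by the metric. -/
noncomputable def gIter {n p q : ℕ} (ω : DF n p q) : (k : ℕ) → DF n (p + k) (q + k)
  | 0 => ω
  | k + 1 => gStep (gIter ω k)

/-- The tensor product of the metric with a double form. -/
noncomputable def gCons {n p q : ℕ} (ω : DF n p q) : DF n (p + 1) (q + 1) := fun x y =>
  (x 0 ⬝ᵥ y 0) * ω (Fin.tail x) (Fin.tail y)

/-- The tensor product of `k` copies of the metric with a double form. -/
noncomputable def gTens {n p q : ℕ} (ω : DF n p q) : (k : ℕ) → DF n (p + k) (q + k)
  | 0 => ω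
  | k + 1 => gCons (gTens ω k)

/-- The permutation sending `0` to `i` and `k + 1` to `i.succAbove (e k)`. -/
def permCons {p : ℕ} (i : Fin (p + 1)) (e : Equiv.Perm (Fin p)) : Equiv.Perm (Fin (p + 1)) :=
  i.cycleRange.symm * Equiv.Perm.decomposeFin.symm (0, e)

theorem permCons_zero {p : ℕ} (i : Fin (p + 1)) (e : Equiv.Perm (Fin p)) :
    permCons i e 0 = i := by
  simp [permCons]

theorem permCons_succ {p : ℕ} (i : Fin (p + 1)) (e : Equiv.Perm (Fin p)) (k : Fin p) :
    permCons i e k.succ = i.succAbove (e k) := by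
  simp [permCons]

theorem sign_permCons {p : ℕ} (i : Fin (p + 1)) (e : Equiv.Perm (Fin p)) :
    ((Equiv.Perm.sign (permCons i e) : ℤ) : ℝ) =
      (-1) ^ (i : ℕ) * ((Equiv.Perm.sign e : ℤ) : ℝ) := by
  simp [permCons, Equiv.Perm.sign_mul]

theorem sum_perm_succ {p : ℕ} (F : Equiv.Perm (Fin (p + 1)) → ℝ) :
    ∑ σ, F σ = ∑ i, ∑ e, F (permCons i e) := by
  have hb : Function.Bijective
      fun a : Fin (p + 1) × Equiv.Perm (Fin p) => permCons a.1 a.2 := by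
    rw [Fintype.bijective_iff_injective_and_card]
    refine ⟨?_, by simp [Fintype.card_perm, Nat.factorial_succ]⟩
    rintro ⟨i, e⟩ ⟨i', e'⟩ h
    have h' : ∀ k, permCons i e k = permCons i' e' k := fun k => by
      simpa using congrArg (fun σ : Equiv.Perm (Fin (p + 1)) => σ k) h
    have hi : i = i' := by simpa [permCons_zero] using h' 0
    subst hi
    have he : e = e' := Equiv.ext fun k => by simpa [permCons_succ] using h' k.succ
    rw [he]
  rw [← hb.sum_comp, Fintype.sum_prod_type]

theorem altz_gCons {n p q : ℕ} (ω : DF n p q) : altz (gCons ω) = gStep (altz ω) := by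
  funext x y
  unfold altz gStep
  rw [sum_perm_succ]
  refine Finset.sum_congr rfl fun i _ => ?_
  rw [Finset.sum_congr rfl fun e _ => sum_perm_succ _, Finset.sum_comm]
  refine Finset.sum_congr rfl fun j _ => ?_
  simp only [Finset.mul_sum]
  refine Finset.sum_congr rfl fun σ _ => Finset.sum_congr rfl fun ρ _ => ?_
  simp only [gCons, sign_permCons, permCons_zero, Fin.tail_def, permCons_succ,
    Fin.removeNth_apply]
  ring

theorem altz_gTens {n p q : ℕ} (ω : DF n p q) (k : ℕ) :
    altz (gTens ω k) = gIter (altz ω) k := by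
  induction k with
  | zero => rfl
  | succ k ih => rw [gIter, ← ih, ← altz_gCons]; rfl

theorem altz_DFcast {n p q p' q' : ℕ} (h1 : p = p') (h2 : q = q') (ω : DF n p q) :
    altz (DFcast h1 h2 ω) = DFcast h1 h2 (altz ω) := by
  subst h1 h2
  rfl

theorem tens_tpow {n p q : ℕ} (k : ℕ) (ω : DF n p q) :
    tens (tpow n k) ω = DFcast (Nat.add_comm p k) (Nat.add_comm q k) (gTens ω k) := by
  have h : ∀ (x : Fin (p + k) → V n) (y : Fin (q + k) → V n), gTens ω k x y =
      tpow n k (fun i => x (Fin.cast (Nat.add_comm k p) (Fin.castAdd p i)))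
        (fun i => y (Fin.cast (Nat.add_comm k q) (Fin.castAdd q i))) *
      ω (fun i => x (Fin.cast (Nat.add_comm k p) (Fin.natAdd k i)))
        (fun i => y (Fin.cast (Nat.add_comm k q) (Fin.natAdd k i))) := by
    induction k with
    | zero =>
      intro x y
      have e : ∀ {p : ℕ} (i : Fin p) (h : 0 + p = p), Fin.cast h (Fin.natAdd 0 i) = i :=
        fun i h => Fin.ext (by simp)
      simp only [gTens, tpow, Finset.univ_eq_empty, Finset.prod_empty, one_mul]
      congr 1 <;> funext i <;> congr 1 <;> exact (e i _).symm
    | succ k ih =>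
      intro x y
      have e : ∀ {p : ℕ} (i : Fin p) (h : k + 1 + p = p + (k + 1)) (h' : k + p = p + k),
          Fin.cast h (Fin.natAdd (k + 1) i) = (Fin.cast h' (Fin.natAdd k i)).succ :=
        fun i h h' => Fin.ext (by simp; omega)
      simp only [gTens, gCons, ih, tpow, Fin.prod_univ_succ]
      simp only [e _ _ (Nat.add_comm k _), mul_assoc]
      rfl
  funext x y
  simp only [DFcast, h]
  rfl

theorem mul_gpow {n p q : ℕ} (k : ℕ) (ω : DF n p q) :
    mul (gpow n k) ω = ((p.factorial * q.factorial : ℕ) : ℝ)⁻¹ •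
      DFcast (Nat.add_comm p k) (Nat.add_comm q k) (gIter (altz ω) k) := by
  funext x y
  rw [gpow_eq_altz, mul_altz, tens_tpow, altz_DFcast, altz_gTens]
  rfl

/-! ### Alternating double forms -/

/-- `ω` is multilinear and alternating in each of the two groups of arguments separately. -/
def SepAlt {n p q : ℕ} (ω : DF n p q) : Prop :=
  (∀ y, ∃ F : V n [⋀^Fin p]→ₗ[ℝ] ℝ, ∀ x, ω x y = F x) ∧
    ∀ x, ∃ F : V n [⋀^Fin q]→ₗ[ℝ] ℝ, ∀ y, ω x y = F y

/-- Evaluation of alternating maps at a fixed family of vectors. -/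
def evalAlt {n q : ℕ} (y : Fin q → V n) : (V n [⋀^Fin q]→ₗ[ℝ] ℝ) →ₗ[ℝ] ℝ where
  toFun F := F y
  map_add' _ _ := rfl
  map_smul' _ _ := rfl

theorem IsDF.sepAlt {n p q : ℕ} {ω : DF n p q} (h : IsDF ω) : SepAlt ω := by
  obtain ⟨F, hF⟩ := h
  exact ⟨fun y => ⟨(evalAlt y).compAlternatingMap F, fun x => hF x y⟩,
    fun x => ⟨F x, fun y => hF x y⟩⟩

theorem altz_of_sepAlt {n p q : ℕ} {ω : DF n p q} (h : SepAlt ω) :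
    altz ω = ((p.factorial * q.factorial : ℕ) : ℝ) • ω := by
  funext x y
  have h1 : ∀ (σ : Equiv.Perm (Fin p)) y, ω (fun i => x (σ i)) y =
      ((Equiv.Perm.sign σ : ℤ) : ℝ) * ω x y := fun σ y => by
    obtain ⟨F, hF⟩ := h.1 y
    rw [hF, hF]
    simpa [Units.smul_def, Function.comp_def] using F.map_perm x σ
  have h2 : ∀ (ρ : Equiv.Perm (Fin q)), ω x (fun j => y (ρ j)) =
      ((Equiv.Perm.sign ρ : ℤ) : ℝ) * ω x y := fun ρ => by
    obtain ⟨F, hF⟩ := h.2 x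
    rw [hF, hF]
    simpa [Units.smul_def, Function.comp_def] using F.map_perm y ρ
  have h3 : ∀ (σ : Equiv.Perm (Fin p)) (ρ : Equiv.Perm (Fin q)),
      ((Equiv.Perm.sign σ : ℤ) : ℝ) * ((Equiv.Perm.sign ρ : ℤ) : ℝ) *
        ω (fun i => x (σ i)) (fun j => y (ρ j)) = ω x y := fun σ ρ => by
    rw [h1, h2]
    linear_combination (((Equiv.Perm.sign ρ : ℤ) : ℝ) * ((Equiv.Perm.sign ρ : ℤ) : ℝ) * ω x y) *
      sign_mul_sign_cast σ + ω x y * sign_mul_sign_cast ρ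
  simp [altz, h3, Fintype.card_perm, mul_assoc]

theorem gStep_smul {n p q : ℕ} (a : ℝ) (ω : DF n p q) : gStep (a • ω) = a • gStep ω := by
  funext x y
  simp only [gStep, Pi.smul_apply, smul_eq_mul, Finset.mul_sum]
  exact Finset.sum_congr rfl fun i _ => Finset.sum_congr rfl fun j _ => by ring

theorem gIter_smul {n p q : ℕ} (a : ℝ) (ω : DF n p q) (k : ℕ) :
    gIter (a • ω) k = a • gIter ω k := by
  induction k with
  | zero => rfl
  | succ k ih => rw [gIter, ih, gStep_smul]; rfl

theorem mul_gpow_of_sepAlt {n p q : ℕ} (k : ℕ) {ω : DF n p q} (h : SepAlt ω) :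
    mul (gpow n k) ω = DFcast (Nat.add_comm p k) (Nat.add_comm q k) (gIter ω k) := by
  have h0 : ((p.factorial * q.factorial : ℕ) : ℝ) ≠ 0 := by positivity
  rw [mul_gpow, altz_of_sepAlt h, gIter_smul]
  funext x y
  exact inv_mul_cancel_left₀ h0 _

theorem exists_alt_sum {n p : ℕ} {ι : Type*} (s : Finset ι) (a : ι → ℝ)
    (f : ι → (Fin p → V n) → ℝ)
    (h : ∀ i, ∃ F : V n [⋀^Fin p]→ₗ[ℝ] ℝ, ∀ x, f i x = F x) :
    ∃ F : V n [⋀^Fin p]→ₗ[ℝ] ℝ, ∀ x, ∑ i ∈ s, a i * f i x = F x := by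
  choose F hF using h
  refine ⟨∑ i ∈ s, a i • F i, fun x => ?_⟩
  refine Eq.trans ?_ (map_sum (evalAlt x) (fun i => a i • F i) s).symm
  exact Finset.sum_congr rfl fun i _ => by rw [hF]; rfl

theorem exists_alt_cons {n p : ℕ} (f : (Fin (p + 1) → V n) → ℝ)
    (h : ∃ F : V n [⋀^Fin (p + 1)]→ₗ[ℝ] ℝ, ∀ x, f x = F x) (v : V n) :
    ∃ F : V n [⋀^Fin p]→ₗ[ℝ] ℝ, ∀ x, f (Fin.cons v x) = F x := by
  obtain ⟨F, hF⟩ := h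
  exact ⟨F.curryLeft v, fun x => hF _⟩

theorem exists_alt_wedge {n p : ℕ} (f : (Fin p → V n) → ℝ)
    (h : ∃ F : V n [⋀^Fin p]→ₗ[ℝ] ℝ, ∀ x, f x = F x) (v : V n) :
    ∃ F : V n [⋀^Fin (p + 1)]→ₗ[ℝ] ℝ,
      ∀ x, ∑ i : Fin (p + 1), (-1 : ℝ) ^ (i : ℕ) * (x i ⬝ᵥ v) * f (i.removeNth x) = F x := by
  obtain ⟨F, hF⟩ := h
  refine ⟨AlternatingMap.alternatizeUncurryFin
    (((dotProductBilin ℝ ℝ).flip v).smulRight F), fun x => ?_⟩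
  rw [AlternatingMap.alternatizeUncurryFin_apply]
  simp [hF, mul_assoc]

/-- Contraction raised to the total space: from bidegree `(p+1,q+1)` to `(p,q)`. -/
noncomputable def cStep {n p q : ℕ} (ω : DF n (p + 1) (q + 1)) : DF n p q := fun x y =>
  ∑ j : Fin n, ω (Fin.cons (E n j) x) (Fin.cons (E n j) y)

theorem SepAlt.cStep {n p q : ℕ} {ω : DF n (p + 1) (q + 1)} (h : SepAlt ω) :
    SepAlt (cStep ω) := by
  constructor
  · intro y
    simpa [DoubleForm.cStep] using exists_alt_sum Finset.univ (fun _ => 1)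
      (fun j x => ω (Fin.cons (E n j) x) (Fin.cons (E n j) y))
      fun j => exists_alt_cons _ (h.1 _) _
  · intro x
    simpa [DoubleForm.cStep] using exists_alt_sum Finset.univ (fun _ => 1)
      (fun j y => ω (Fin.cons (E n j) x) (Fin.cons (E n j) y))
      fun j => exists_alt_cons _ (h.2 _) _

theorem SepAlt.gStep {n p q : ℕ} {ω : DF n p q} (h : SepAlt ω) : SepAlt (gStep ω) := by
  constructor
  · intro y
    obtain ⟨F, hF⟩ := exists_alt_sum Finset.univ (fun j : Fin (q + 1) => (-1 : ℝ) ^ (j : ℕ))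
      (fun j x => ∑ i : Fin (p + 1), (-1 : ℝ) ^ (i : ℕ) * (x i ⬝ᵥ y j) *
        ω (i.removeNth x) (j.removeNth y))
      fun j => exists_alt_wedge _ (h.1 _) _
    refine ⟨F, fun x => ?_⟩
    rw [← hF, DoubleForm.gStep, Finset.sum_comm]
    simp only [Finset.mul_sum]
    exact Finset.sum_congr rfl fun i _ => Finset.sum_congr rfl fun j _ => by ring
  · intro x
    obtain ⟨F, hF⟩ := exists_alt_sum Finset.univ (fun i : Fin (p + 1) => (-1 : ℝ) ^ (i : ℕ))
      (fun i y => ∑ j : Fin (q + 1), (-1 : ℝ) ^ (j : ℕ) * (y j ⬝ᵥ x i) *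
        ω (i.removeNth x) (j.removeNth y))
      fun j => exists_alt_wedge _ (h.2 _) _
    refine ⟨F, fun y => ?_⟩
    rw [← hF, DoubleForm.gStep]
    simp only [Finset.mul_sum]
    refine Finset.sum_congr rfl fun i _ => Finset.sum_congr rfl fun j _ => ?_
    rw [dotProduct_comm (y j)]
    ring

/-! ### The commutator of contraction and multiplication by the metric -/

theorem E_eq_single (n : ℕ) (j : Fin n) : E n j = Pi.single j 1 := by
  funext k
  simp [E, Pi.single_apply]

theorem sum_dotProduct_mul_alt {n q : ℕ} (F : V n [⋀^Fin q]→ₗ[ℝ] ℝ) (y : Fin q → V n)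
    (j : Fin q) :
    ∑ a : Fin n, (-1 : ℝ) ^ (j.succ : ℕ) * (E n a ⬝ᵥ y j) *
      F (j.succ.removeNth (Fin.cons (E n a) y : Fin (q + 1) → V n)) = - F y := by
  cases q with
  | zero => exact j.elim0
  | succ q =>
    have h1 : ∀ a, (j.succ.removeNth (Fin.cons (E n a) y : Fin (q + 2) → V n)) =
        Fin.cons (E n a) (j.removeNth y) := fun a => Fin.cons_comp_succ_succAbove _ _ _
    have h2 : ∑ a, (E n a ⬝ᵥ y j) * F (Fin.cons (E n a) (j.removeNth y)) =
        F (Fin.cons (y j) (j.removeNth y)) := by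
      have hy : y j = ∑ a, (E n a ⬝ᵥ y j) • E n a := by
        funext k
        simp [E_eq_single, Finset.sum_apply, Pi.single_apply]
      have := congrArg (fun v => evalAlt (j.removeNth y) (F.curryLeft v)) hy
      simp only [map_sum, map_smul] at this
      exact this.symm
    have h3 : F (Fin.cons (y j) (j.removeNth y)) = (-1 : ℝ) ^ (j : ℕ) * F y := by
      have := F.neg_one_pow_smul_map_insertNth j (y j) (j.removeNth y)
      rw [Fin.insertNth_self_removeNth] at this
      exact Eq.trans rfl (this.symm.trans (by simp))
    simp only [h1, mul_assoc, ← Finset.mul_sum]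
    rw [h2, h3, ← mul_assoc, ← pow_add, Fin.val_succ, Odd.neg_one_pow ⟨j, by ring⟩, neg_one_mul]

/-- The part of the contraction of `g ω` in which the contracted vectors enter `ω`. -/
noncomputable def cgRest {n p q : ℕ} (ω : DF n p q) : DF n p q := fun x y =>
  ∑ a : Fin n, ∑ i : Fin p, ∑ j : Fin q,
    (-1 : ℝ) ^ (i : ℕ) * (-1 : ℝ) ^ (j : ℕ) * (x i ⬝ᵥ y j) *
      ω (i.succ.removeNth (Fin.cons (E n a) x : Fin (p + 1) → V n))
        (j.succ.removeNth (Fin.cons (E n a) y : Fin (q + 1) → V n))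

theorem cStep_gStep {n p q : ℕ} {ω : DF n p q} (h : SepAlt ω) :
    cStep (gStep ω) = cgRest ω + ((n : ℝ) - p - q) • ω := by
  funext x y
  have hr : ∀ {m : ℕ} (v : V n) (z : Fin m → V n),
      (0 : Fin (m + 1)).removeNth (Fin.cons v z : Fin (m + 1) → V n) = z :=
    fun v z => Fin.removeNth_zero _
  have h1 : ∀ j : Fin q, ∑ a : Fin n, (-1 : ℝ) ^ (j.succ : ℕ) * (E n a ⬝ᵥ y j) *
      ω x (j.succ.removeNth (Fin.cons (E n a) y : Fin (q + 1) → V n)) = - ω x y := fun j => by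
    obtain ⟨F, hF⟩ := h.2 x
    simp only [hF]
    exact sum_dotProduct_mul_alt F y j
  have h2 : ∀ i : Fin p, ∑ a : Fin n, (-1 : ℝ) ^ (i.succ : ℕ) * (x i ⬝ᵥ E n a) *
      ω (i.succ.removeNth (Fin.cons (E n a) x : Fin (p + 1) → V n)) y = - ω x y := fun i => by
    obtain ⟨F, hF⟩ := h.1 y
    simp only [hF, dotProduct_comm (x i)]
    exact sum_dotProduct_mul_alt F x i
  have h0 : ∀ a, E n a ⬝ᵥ E n a = 1 := fun a => by simp [E_eq_single]
  simp only [cStep, gStep, Fin.sum_univ_succ, Fin.cons_zero, Fin.cons_succ, hr, h0,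
    Finset.sum_add_distrib, Fin.val_zero, pow_zero, one_mul, mul_one]
  rw [Finset.sum_comm.trans (Finset.sum_congr rfl fun i _ => h2 i),
    Finset.sum_comm.trans (Finset.sum_congr rfl fun j _ => h1 j)]
  simp only [cgRest, Pi.add_apply, Pi.smul_apply, Finset.sum_const, Finset.card_univ,
    Fintype.card_fin, smul_eq_mul, nsmul_eq_mul, Fin.val_succ, pow_succ]
  ring_nf

theorem gStep_cStep {n p q : ℕ} (ω : DF n (p + 1) (q + 1)) :
    gStep (cStep ω) = cgRest ω := by
  funext x y
  have h1 : ∀ {m : ℕ} (j : Fin (m + 1)) (z : Fin (m + 1) → V n) a,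
      (j.succ.removeNth (Fin.cons (E n a) z : Fin (m + 2) → V n)) =
        Fin.cons (E n a) (j.removeNth z) := fun j z a => Fin.cons_comp_succ_succAbove _ _ _
  simp only [gStep, cStep, cgRest, h1, Finset.mul_sum]
  rw [Finset.sum_comm_cycle]

/-! ### The total space of double forms -/

/-- Contraction on the total space. -/
noncomputable def contrTotal (n : ℕ) : DT n →ₗ[ℝ] DT n where
  toFun η := fun p q => cStep (η (p + 1) (q + 1))
  map_add' η θ := by
    funext p q x y
    simp [cStep, Finset.sum_add_distrib]
  map_smul' a η := by
    funext p q x y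
    simp [cStep, Finset.mul_sum]

/-- Multiplication by the metric on the total space. -/
noncomputable def metricTotal (n : ℕ) : DT n →ₗ[ℝ] DT n where
  toFun η
    | p + 1, q + 1 => gStep (η p q)
    | 0, _ => 0
    | _ + 1, 0 => 0
  map_add' η θ := by
    funext p q
    rcases p with _ | p
    · simp
    rcases q with _ | q
    · simp
    funext x y
    simp [gStep, Finset.sum_add_distrib, mul_add]
  map_smul' a η := by
    funext p q
    rcases p with _ | p
    · simp
    rcases q with _ | q
    · simp
    exact gStep_smul a _

/-- The grading operator, acting on bidegree `(p,q)` as multiplication by `n - p - q`. -/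
noncomputable def weightTotal (n : ℕ) : DT n →ₗ[ℝ] DT n where
  toFun η := fun p q => ((n : ℝ) - p - q) • η p q
  map_add' η θ := by
    funext p q
    simp
  map_smul' a η := by
    funext p q
    exact smul_comm ((n : ℝ) - p - q) a (η p q)

/-- The total space of (separately) alternating double forms. -/
def altTotal (n : ℕ) : Submodule ℝ (DT n) where
  carrier := {η | ∀ p q, SepAlt (η p q)}
  zero_mem' p q := ⟨fun _ => ⟨0, fun _ => rfl⟩, fun _ => ⟨0, fun _ => rfl⟩⟩
  add_mem' {η θ} hη hθ p q := by
    refine ⟨fun y => ?_, fun x => ?_⟩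
    · obtain ⟨F, hF⟩ := (hη p q).1 y
      obtain ⟨G, hG⟩ := (hθ p q).1 y
      exact ⟨F + G, fun x => by simp [hF, hG]⟩
    · obtain ⟨F, hF⟩ := (hη p q).2 x
      obtain ⟨G, hG⟩ := (hθ p q).2 x
      exact ⟨F + G, fun y => by simp [hF, hG]⟩
  smul_mem' a η hη p q := by
    refine ⟨fun y => ?_, fun x => ?_⟩
    · obtain ⟨F, hF⟩ := (hη p q).1 y
      exact ⟨a • F, fun x => by simp [hF]⟩
    · obtain ⟨F, hF⟩ := (hη p q).2 x
      exact ⟨a • F, fun y => by simp [hF]⟩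

theorem contrTotal_mem {n : ℕ} : ∀ η ∈ altTotal n, contrTotal n η ∈ altTotal n :=
  fun _ hη p q => (hη (p + 1) (q + 1)).cStep

theorem metricTotal_mem {n : ℕ} : ∀ η ∈ altTotal n, metricTotal n η ∈ altTotal n := by
  intro η hη p q
  rcases p with _ | p
  · exact (altTotal n).zero_mem 0 q
  rcases q with _ | q
  · exact (altTotal n).zero_mem (p + 1) 0
  exact (hη p q).gStep

theorem weightTotal_mem {n : ℕ} : ∀ η ∈ altTotal n, weightTotal n η ∈ altTotal n :=
  fun _ hη p q => (altTotal n).smul_mem _ hη p q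

theorem contrTotal_metricTotal {n : ℕ} {η : DT n} (hη : η ∈ altTotal n) :
    contrTotal n (metricTotal n η) = metricTotal n (contrTotal n η) + weightTotal n η := by
  funext p q
  refine (cStep_gStep (hη p q)).trans (congrArg (· + _) ?_)
  rcases p with _ | p
  · funext x y
    simp [cgRest, metricTotal]
  rcases q with _ | q
  · funext x y
    simp [cgRest, metricTotal]
  exact (gStep_cStep _).symm

theorem weightTotal_contrTotal {n : ℕ} (η : DT n) :
    weightTotal n (contrTotal n η) =
      contrTotal n (weightTotal n η) + (2 : ℝ) • contrTotal n η := by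
  funext p q x y
  simp only [weightTotal, contrTotal, LinearMap.coe_mk, AddHom.coe_mk, cStep, Pi.add_apply,
    Pi.smul_apply, smul_eq_mul, ← Finset.mul_sum]
  push_cast
  ring

theorem weightTotal_metricTotal {n : ℕ} (η : DT n) :
    weightTotal n (metricTotal n η) =
      metricTotal n (weightTotal n η) - (2 : ℝ) • metricTotal n η := by
  funext p q
  rcases p with _ | p
  · simp [weightTotal, metricTotal]
  rcases q with _ | q
  · simp [weightTotal, metricTotal]
  simp only [weightTotal, metricTotal, LinearMap.coe_mk, AddHom.coe_mk, gStep_smul, Pi.sub_apply,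
    Pi.smul_apply]
  rw [← sub_smul]
  congr 1
  push_cast
  ring

/-! ### Commutation on the zero weight space of an `sl₂`-triple -/

section Triple

variable {M : Type*} [AddCommGroup M] [Module ℝ M] {e f h : Module.End ℝ M}

theorem pow_apply_of_weight_raise (hhe : ∀ v, h (e v) = e (h v) + (2 : ℝ) • e v) (k : ℕ) {v : M}
    (hv : h v = 0) : h ((e ^ k) v) = (2 * k : ℝ) • (e ^ k) v := by
  induction k with
  | zero => simpa using hv
  | succ k ih =>
    rw [pow_succ', Module.End.mul_apply, hhe, ih, map_smul]
    push_cast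
    module

theorem pow_apply_of_weight_lower (hhf : ∀ v, h (f v) = f (h v) - (2 : ℝ) • f v) (k : ℕ) {v : M}
    (hv : h v = 0) : h ((f ^ k) v) = (-(2 * k) : ℝ) • (f ^ k) v := by
  induction k with
  | zero => simpa using hv
  | succ k ih =>
    rw [pow_succ', Module.End.mul_apply, hhf, ih, map_smul]
    push_cast
    module

/-- If `[e, f] = h`, `[h, e] = 2e` and `[h, f] = -2f`, then `e ^ k` and `f ^ k` commute on the
kernel of `h`. -/
theorem pow_mul_pow_comm_of_weight_zero (hef : ∀ v, e (f v) = f (e v) + h v)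
    (hhe : ∀ v, h (e v) = e (h v) + (2 : ℝ) • e v)
    (hhf : ∀ v, h (f v) = f (h v) - (2 : ℝ) • f v) (k : ℕ) {v : M} (hv : h v = 0) :
    (e ^ k) ((f ^ k) v) = (f ^ k) ((e ^ k) v) := by
  -- `Ω` is the Casimir operator
  let Ω : Module.End ℝ M := (4 : ℝ) • (f * e) + h * h + (2 : ℝ) • h
  have hΩ : ∀ v, Ω v = (4 : ℝ) • f (e v) + h (h v) + (2 : ℝ) • h v := fun v => rfl
  have hΩe : Commute Ω e := LinearMap.ext fun v => by
    simp only [Module.End.mul_apply, hΩ, hef, hhe, map_add, map_smul]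
    module
  have hΩf : Commute Ω f := LinearMap.ext fun v => by
    simp only [Module.End.mul_apply, hΩ, hef, hhf, map_add, map_sub, map_smul]
    module
  induction k generalizing v with
  | zero => rfl
  | succ k ih =>
    have hw : h (Ω v - (4 * k * (k + 1) : ℝ) • v) = 0 := by
      simp only [hΩ, hhf, hhe, map_add, map_sub, map_smul, hv, map_zero]
      module
    have h1 : (4 : ℝ) • e (f ((f ^ k) v)) = (f ^ k) (Ω v - (4 * k * (k + 1) : ℝ) • v) := by
      have h2 := LinearMap.congr_fun (hΩf.pow_right k).eq v
      simp only [Module.End.mul_apply] at h2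
      rw [map_sub, ← h2, hΩ, map_smul, hef, pow_apply_of_weight_lower hhf k hv, map_smul,
        pow_apply_of_weight_lower hhf k hv]
      module
    have h3 : (4 : ℝ) • f (e ((e ^ k) v)) = (e ^ k) (Ω v - (4 * k * (k + 1) : ℝ) • v) := by
      have h2 := LinearMap.congr_fun (hΩe.pow_right k).eq v
      simp only [Module.End.mul_apply] at h2
      rw [map_sub, ← h2, hΩ, map_smul, pow_apply_of_weight_raise hhe k hv, map_smul,
        pow_apply_of_weight_raise hhe k hv]
      module
    have h4 : (4 : ℝ) • (e ^ (k + 1)) ((f ^ (k + 1)) v) =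
        (4 : ℝ) • (f ^ (k + 1)) ((e ^ (k + 1)) v) := by
      calc (4 : ℝ) • (e ^ (k + 1)) ((f ^ (k + 1)) v)
          = (e ^ k) ((4 : ℝ) • e (f ((f ^ k) v))) := by
            rw [pow_succ e, pow_succ' f, map_smul]; rfl
        _ = (f ^ k) ((4 : ℝ) • f (e ((e ^ k) v))) := by rw [h1, h3, ih hw]
        _ = (4 : ℝ) • (f ^ (k + 1)) ((e ^ (k + 1)) v) := by
            rw [pow_succ f, pow_succ' e, map_smul]; rfl
    exact smul_right_injective M (four_ne_zero (α := ℝ)) h4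

end Triple

theorem contrTotal_pow_metricTotal_pow {n : ℕ} {η : DT n} (hη : η ∈ altTotal n)
    (h0 : weightTotal n η = 0) (k : ℕ) :
    (contrTotal n ^ k) ((metricTotal n ^ k) η) = (metricTotal n ^ k) ((contrTotal n ^ k) η) := by
  have h := pow_mul_pow_comm_of_weight_zero
    (e := (contrTotal n).restrict contrTotal_mem) (f := (metricTotal n).restrict metricTotal_mem)
    (h := (weightTotal n).restrict weightTotal_mem)
    (fun v => Subtype.ext (contrTotal_metricTotal v.2))
    (fun v => Subtype.ext (weightTotal_contrTotal v.1))
    (fun v => Subtype.ext (weightTotal_metricTotal v.1)) k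
    (v := ⟨η, hη⟩) (Subtype.ext h0)
  rw [Module.End.pow_restrict k contrTotal_mem, Module.End.pow_restrict k metricTotal_mem] at h
  exact congrArg Subtype.val h

/-! ### Embedding into the total space -/

theorem emb_DFcast {n p q p' q' : ℕ} (h1 : p = p') (h2 : q = q') (ω : DF n p q) :
    emb p' q' (DFcast h1 h2 ω) = emb p q ω := by
  subst h1 h2
  rfl

theorem emb_apply_self {n : ℕ} (p q : ℕ) (ω : DF n p q) : emb p q ω p q = ω := by
  simp only [emb, and_self, dif_pos]
  rfl

theorem emb_apply_of_ne {n p q p' q' : ℕ} (ω : DF n p q) (h : ¬(p = p' ∧ q = q')) :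
    emb p q ω p' q' = 0 :=
  dif_neg h

theorem emb_zero (n p q : ℕ) : emb p q (0 : DF n p q) = 0 := by
  funext p' q'
  by_cases h : p = p' ∧ q = q'
  · obtain ⟨rfl, rfl⟩ := h
    exact emb_apply_self _ _ _
  · exact emb_apply_of_ne _ h

theorem emb_mem {n p q : ℕ} {ω : DF n p q} (h : SepAlt ω) : emb p q ω ∈ altTotal n := by
  intro p' q'
  by_cases hpq : p = p' ∧ q = q'
  · obtain ⟨rfl, rfl⟩ := hpq
    rwa [emb_apply_self]
  · rw [emb_apply_of_ne _ hpq]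
    exact (altTotal n).zero_mem p' q'

theorem emb_contr {n : ℕ} : ∀ {p q : ℕ} (ω : DF n p q),
    emb (p - 1) (q - 1) (contr ω) = contrTotal n (emb p q ω)
  | p + 1, q + 1, ω => by
    funext p' q'
    by_cases h : p = p' ∧ q = q'
    · obtain ⟨rfl, rfl⟩ := h
      refine (emb_apply_self p q (contr ω)).trans ?_
      exact (congrArg cStep (emb_apply_self (p + 1) (q + 1) ω)).symm
    · refine (emb_apply_of_ne _ h).trans ?_
      have h' : ¬(p + 1 = p' + 1 ∧ q + 1 = q' + 1) := by simpa using h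
      refine Eq.trans ?_ (congrArg cStep (emb_apply_of_ne ω h')).symm
      funext x y
      simp [cStep]
  | 0, q, ω => by
    refine (emb_zero n (0 - 1) (q - 1)).trans ?_
    funext p' q' x y
    simp [contrTotal, cStep, emb]
  | p + 1, 0, ω => by
    refine (emb_zero n (p + 1 - 1) (0 - 1)).trans ?_
    funext p' q' x y
    simp [contrTotal, cStep, emb]

theorem emb_ck {n p q : ℕ} (ω : DF n p q) (k : ℕ) :
    emb (p - k) (q - k) (ck k ω) = (contrTotal n ^ k) (emb p q ω) := by
  induction k with
  | zero => rfl
  | succ k ih =>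
    rw [pow_succ', Module.End.mul_apply, ← ih, ← emb_contr]
    rfl

theorem emb_gStep {n p q : ℕ} (ω : DF n p q) :
    emb (p + 1) (q + 1) (gStep ω) = metricTotal n (emb p q ω) := by
  funext p' q'
  rcases p' with _ | p'
  · exact emb_apply_of_ne _ (by simp)
  rcases q' with _ | q'
  · exact emb_apply_of_ne _ (by simp)
  by_cases h : p = p' ∧ q = q'
  · obtain ⟨rfl, rfl⟩ := h
    rw [emb_apply_self]
    exact (congrArg gStep (emb_apply_self p q ω)).symm
  · rw [emb_apply_of_ne _ (by simpa using h)]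
    refine Eq.trans ?_ (congrArg gStep (emb_apply_of_ne ω h)).symm
    funext x y
    simp [gStep]

theorem emb_mul_gpow {n p q : ℕ} {ω : DF n p q} (h : SepAlt ω) (k : ℕ) :
    emb (k + p) (k + q) (mul (gpow n k) ω) = (metricTotal n ^ k) (emb p q ω) := by
  rw [mul_gpow_of_sepAlt k h, emb_DFcast]
  induction k with
  | zero => rfl
  | succ k ih =>
    rw [pow_succ', Module.End.mul_apply, ← ih, ← emb_gStep]
    rfl

theorem SepAlt.contr {n : ℕ} : ∀ {p q : ℕ} {ω : DF n p q}, SepAlt ω → SepAlt (contr ω)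
  | _ + 1, _ + 1, _, h => h.cStep
  | 0, q, _, _ => (altTotal n).zero_mem (0 - 1) (q - 1)
  | p + 1, 0, _, _ => (altTotal n).zero_mem (p + 1 - 1) (0 - 1)

theorem SepAlt.ck {n p q : ℕ} {ω : DF n p q} (h : SepAlt ω) (k : ℕ) : SepAlt (ck k ω) := by
  induction k with
  | zero => exact h
  | succ k ih => exact ih.contr

theorem weightTotal_emb {n p q : ℕ} (hn : n = p + q) (ω : DF n p q) :
    weightTotal n (emb p q ω) = 0 := by
  funext p' q'
  by_cases h : p = p' ∧ q = q'
  · obtain ⟨rfl, rfl⟩ := h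
    simp [weightTotal, hn]
  · simp [weightTotal, emb_apply_of_ne _ h]

/-- if `n = p + q` then `c^k(g^k ω) = g^k(c^k ω)` for every `k`. -/
theorem ck_gk_comm (n p q : ℕ) (hn : n = p + q) (ω : DF n p q) (hω : IsDF ω) (k : ℕ) :
    emb (k + p - k) (k + q - k) (ck k (mul (gpow n k) ω))
      = emb (k + (p - k)) (k + (q - k)) (mul (gpow n k) (ck k ω)) := by
  have h := hω.sepAlt
  rw [emb_ck, emb_mul_gpow h, emb_mul_gpow (h.ck k), emb_ck]
  exact contrTotal_pow_metricTotal_pow (emb_mem h) (weightTotal_emb hn ω) k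


end DoubleForm
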